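/- Let k > 1 and m > 1 be integers with k odd, and let s, t be integers with 0 ≤ s < k and 1 ≤ t < m. Set r = sm + t, and assume gcd(r, k) = 1 and r − tk < 0. For an integer N ≥ 0, let p^e_{m,k,s,t}(N) (respectively p^o_{m,k,s,t}(N)) denote the number of partitions of N into parts (possibly repeated) congruent to ±r modulo mk together with distinct parts congruent to ±(tk − r) modulo mk, in which the total number of parts, counted with multiplicity, is even (respectively odd). Then for every integer n with nk − r(s+1) ≥ 0, p^e_{m,k,s,t}(nk − r(s+1)) = p^o_{m,k,s,t}(nk − r(s+1)). -/

import Mathlib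

/-- The multiset `P` of parts satisfies: every part is congruent to `±r` or `±b`
modulo `m * k`, and every part congruent to `±b` modulo `m * k` occurs at most once
(parts congruent to `±r` may repeat). -/
def AdmissibleParts (m k r b : ℕ) (P : Multiset ℕ) : Prop :=
  (∀ x ∈ P, (x : ZMod (m * k)) = (r : ZMod (m * k)) ∨
      (x : ZMod (m * k)) = -(r : ZMod (m * k)) ∨
      (x : ZMod (m * k)) = (b : ZMod (m * k)) ∨
      (x : ZMod (m * k)) = -(b : ZMod (m * k))) ∧
  (∀ x ∈ P, ((x : ZMod (m * k)) = (b : ZMod (m * k)) ∨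
      (x : ZMod (m * k)) = -(b : ZMod (m * k))) → P.count x ≤ 1)

/-- The number of partitions of `N` into parts (possibly repeated) congruent to `±r`
modulo `m * k` together with distinct parts congruent to `±b` modulo `m * k`, in which
the total number of parts, counted with multiplicity, is even. -/
noncomputable def evenPartitionCount (m k r b N : ℕ) : ℕ :=
  Nat.card {p : N.Partition // AdmissibleParts m k r b p.parts ∧ Even (Multiset.card p.parts)}

/-- As `evenPartitionCount`, but with an odd total number of parts. -/
noncomputable def oddPartitionCount (m k r b N : ℕ) : ℕ :=
  Nat.card {p : N.Partition // AdmissibleParts m k r b p.parts ∧ Odd (Multiset.card p.parts)}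

open Finset

/-- If `c + c (· - D) = e` and `c` vanishes on negative integers, then `c` is an alternating sum
of shifts of `e`. -/
lemma eq_alternating_sum_of_add_shift (c e : ℤ → ℤ) (D : ℤ) (he : ∀ w, c w + c (w - D) = e w)
    (hc : ∀ w < 0, c w = 0) (w : ℤ) (J : ℕ) (hJ : w < J * D) :
    c w = ∑ j ∈ range J, (-1) ^ j * e (w - j * D) := by
  have key : ∀ J : ℕ, c w = ∑ j ∈ range J, (-1) ^ j * e (w - j * D) + (-1) ^ J * c (w - J * D) := by
    intro J
    induction J with
    | zero => simp
    | succ J ih =>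
      rw [sum_range_succ, ← he, ih]
      push_cast
      rw [show w - (J + 1 : ℤ) * D = w - J * D - D by ring]
      ring
  rw [key J, hc _ (by linarith)]
  simp

lemma alternating_diagonal_sum_eq_zero (c : ℤ → ℤ → ℤ) (e : ℤ → ℤ) (r d : ℤ) (n K : ℕ)
    (hr : 0 < r) (hrd : r < d) (hc : ∀ l, ∀ w < 0, c l w = 0)
    (he : ∀ l w, c l w + c l (w - (d * l - r)) = e w) (hK : n ≤ K) :
    ∑ l ∈ range (K + 1), (-1) ^ (l + 1) * c (l + 1) (n - r * (l + 1)) +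
      ∑ l ∈ range (K + 1), (-1) ^ l * c (-l) (n + r * l) = 0 := by
  have hK' : (n : ℤ) ≤ K := by exact_mod_cast hK
  have hpos (l : ℕ) : c (l + 1) (n - r * (l + 1)) = ∑ j ∈ range (K + 1),
      (-1) ^ j * e (n - r * (l + 1) - j * (d * (l + 1) - r)) := by
    refine eq_alternating_sum_of_add_shift _ e _ (he _) (hc _) _ _ ?_
    push_cast
    have hl : (0 : ℤ) ≤ l := by positivity
    have : 1 ≤ d * (l + 1) - r := by nlinarith
    nlinarith
  have hneg (l : ℕ) : c (-l) (n + r * l) = ∑ j ∈ range (K + 1),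
      (-1) ^ j * e (n - r * (j + 1) - l * (d * (j + 1) - r)) := by
    rw [eq_alternating_sum_of_add_shift (c (-l)) (fun w ↦ e (w - (r + d * l))) (r + d * l) ?_
      (hc _) (n + r * l) (K + 1) ?_]
    · refine sum_congr rfl fun j _ ↦ ?_
      congr 2
      ring
    · intro w
      rw [← he (-l)]
      rw [show w - (r + d * l) - (d * -l - r) = w by ring]
      ring
    · push_cast
      have hl : (0 : ℤ) ≤ l := by positivity
      have : r * l ≤ d * l := by nlinarith
      have : 0 ≤ (K : ℤ) * (d * l) := by
        have : 0 < d := by linarith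
        positivity
      nlinarith
  simp_rw [hpos, hneg, mul_sum]
  rw [sum_comm (s := range (K + 1)) (t := range (K + 1))
    (f := fun l j : ℕ ↦ (-1 : ℤ) ^ l * ((-1) ^ j * e (n - r * (j + 1) - l * (d * (j + 1) - r)))),
    ← sum_add_distrib]
  refine sum_eq_zero fun l _ ↦ ?_
  rw [← sum_add_distrib]
  refine sum_eq_zero fun j _ ↦ ?_
  ring

/-- Splitting an admissible multiset of parts by residue class: the four entries list the quotients
by the modulus of the parts congruent to `r`, `-r`, `b` and `-b` respectively. -/
abbrev PartQuad := Multiset ℕ × Multiset ℕ × Finset ℕ × Finset ℕ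

namespace PartQuad

/-- The number of parts congruent to `r` or `-b` minus the number congruent to `-r` or `b`. -/
def charge : PartQuad → ℤ
  | (A, B, C, D) => A.card - B.card - C.card + D.card

/-- The energy `w` for which the encoded parts, with `b = t k - r` and modulus `m k`, have sum
`r N + k w`, where `N` is the charge. -/
def energy (m t : ℤ) : PartQuad → ℤ
  | (A, B, C, D) => m * A.sum + m * (B.sum + B.card) + (m * ∑ j ∈ C, j + t * C.card) +
      (m * ∑ j ∈ D, j + (m - t) * D.card)

lemma energy_nonneg {m t : ℤ} (ht : 0 ≤ t) (htm : t ≤ m) (Q : PartQuad) : 0 ≤ energy m t Q := by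
  obtain ⟨A, B, C, D⟩ := Q
  have : 0 ≤ m := ht.trans htm
  have : 0 ≤ m - t := by linarith
  simp only [energy]
  positivity

end PartQuad

lemma sum_map_succ (A : Multiset ℕ) : (A.map (· + 1)).sum = A.sum + A.card := by
  simp [Multiset.sum_map_add]

/-- A finite set of naturals is determined by whether it contains `0` and by its positive elements,
lowered by one. -/
def finsetShift : Finset ℕ ≃ Bool × Finset ℕ where
  toFun C := (decide (0 ∈ C), (C.erase 0).image (· - 1))
  invFun p := if p.1 then insert 0 (p.2.image (· + 1)) else p.2.image (· + 1)
  left_inv C := by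
    ext x
    have hx (x : ℕ) : (∃ a ∈ C.erase 0, a - 1 = x) ↔ x + 1 ∈ C := by
      refine ⟨?_, fun h ↦ ⟨x + 1, by simpa using h, rfl⟩⟩
      rintro ⟨a, ha, rfl⟩
      rw [mem_erase] at ha
      rw [Nat.sub_add_cancel (Nat.one_le_iff_ne_zero.2 ha.1)]
      exact ha.2
    by_cases h : 0 ∈ C <;> rcases x with _ | x <;> simp [h, -mem_erase, -erase_eq_of_notMem, hx]
  right_inv p := by
    rcases p with ⟨_ | _, C⟩ <;> simp
    all_goals
      ext x
      simp

lemma card_finsetShift_symm (β : Bool) (C : Finset ℕ) :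
    (finsetShift.symm (β, C)).card = C.card + β.toNat := by
  have hinj : Function.Injective (· + 1 : ℕ → ℕ) := add_left_injective 1
  cases β <;> simp [finsetShift, card_image_of_injective _ hinj]

lemma sum_finsetShift_symm (β : Bool) (C : Finset ℕ) :
    ∑ j ∈ finsetShift.symm (β, C), j = ∑ j ∈ C, j + C.card := by
  have hinj : Function.Injective (· + 1 : ℕ → ℕ) := add_left_injective 1
  cases β <;> simp [finsetShift, sum_image hinj.injOn, sum_add_distrib]

lemma Set.ncard_inter_range_of_injective {α β : Type*} {f : α → β} (hf : Function.Injective f)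
    (S : Set β) : (S ∩ Set.range f).ncard = (f ⁻¹' S).ncard := by
  rw [← Set.image_preimage_eq_inter_range, Set.ncard_image_of_injective _ hf]

namespace PartQuad

/-- The quadruples of given charge and energy. -/
def level (m t N w : ℤ) : Set PartQuad := {Q | charge Q = N ∧ energy m t Q = w}

/-- Inserts `0` into the first entry. -/
def consFst : PartQuad → PartQuad
  | (A, B, C, D) => (0 ::ₘ A, B, C, D)

/-- Inserts `0` into the second entry. -/
def consSnd : PartQuad → PartQuad
  | (A, B, C, D) => (A, 0 ::ₘ B, C, D)

/-- Parametrizes the quadruples whose second entry does not contain `0`. -/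
def raiseSnd : PartQuad × Bool → PartQuad
  | ((A, B, C, D), β) => (A, B.map (· + 1), finsetShift.symm (β, C), D)

/-- Parametrizes the quadruples whose first entry does not contain `0`. -/
def raiseFst : PartQuad × Bool → PartQuad
  | ((A, B, C, D), β) => (A.map (· + 1), B, C, finsetShift.symm (!β, D))

lemma consFst_injective : Function.Injective consFst := by
  rintro ⟨A, B, C, D⟩ ⟨A', B', C', D'⟩ h
  simpa [consFst] using h

lemma consSnd_injective : Function.Injective consSnd := by
  rintro ⟨A, B, C, D⟩ ⟨A', B', C', D'⟩ h
  simpa [consSnd] using h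

lemma raiseFst_injective : Function.Injective raiseFst := by
  rintro ⟨⟨A, B, C, D⟩, β⟩ ⟨⟨A', B', C', D'⟩, β'⟩ h
  simp only [raiseFst, Prod.mk.injEq, EmbeddingLike.apply_eq_iff_eq, Bool.not_inj_iff] at h
  obtain ⟨hA, rfl, rfl, rfl, rfl⟩ := h
  rw [Multiset.map_injective (add_left_injective 1) hA]

lemma raiseSnd_injective : Function.Injective raiseSnd := by
  rintro ⟨⟨A, B, C, D⟩, β⟩ ⟨⟨A', B', C', D'⟩, β'⟩ h
  simp only [raiseSnd, Prod.mk.injEq, EmbeddingLike.apply_eq_iff_eq] at h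
  obtain ⟨rfl, hB, ⟨rfl, rfl⟩, rfl⟩ := h
  rw [Multiset.map_injective (add_left_injective 1) hB]

lemma exists_map_succ_iff {A : Multiset ℕ} : (∃ A' : Multiset ℕ, A'.map (· + 1) = A) ↔ 0 ∉ A := by
  constructor
  · rintro ⟨A', rfl⟩
    simp
  · intro hA
    refine ⟨A.map (· - 1), ?_⟩
    rw [Multiset.map_map]
    conv_rhs => rw [← Multiset.map_id A]
    refine Multiset.map_congr rfl fun x hx ↦ ?_
    have : x ≠ 0 := fun h ↦ hA (h ▸ hx)
    simp only [Function.comp_apply, id_eq]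
    omega

lemma range_raiseFst : Set.range raiseFst = (Set.range consFst)ᶜ := by
  ext ⟨A, B, C, D⟩
  have hcons : (A, B, C, D) ∈ Set.range consFst ↔ 0 ∈ A := by
    simp only [Set.mem_range, Prod.exists, consFst, Prod.mk.injEq]
    constructor
    · rintro ⟨A', B', C', D', h⟩
      simp [← h.1]
    · intro h
      obtain ⟨E, rfl⟩ := Multiset.exists_cons_of_mem h
      exact ⟨E, B, C, D, by simp⟩
  rw [Set.mem_compl_iff, hcons, ← exists_map_succ_iff]
  constructor
  · rintro ⟨⟨⟨A', B', C', D'⟩, β⟩, h⟩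
    exact ⟨A', congrArg Prod.fst h⟩
  · rintro ⟨A', rfl⟩
    exact ⟨((A', B, C, (finsetShift D).2), !(finsetShift D).1), by simp [raiseFst]⟩

lemma range_raiseSnd : Set.range raiseSnd = (Set.range consSnd)ᶜ := by
  ext ⟨A, B, C, D⟩
  have hcons : (A, B, C, D) ∈ Set.range consSnd ↔ 0 ∈ B := by
    simp only [Set.mem_range, Prod.exists, consSnd, Prod.mk.injEq]
    constructor
    · rintro ⟨A', B', C', D', h⟩
      simp [← h.2.1]
    · intro h
      obtain ⟨E, rfl⟩ := Multiset.exists_cons_of_mem h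
      exact ⟨A, E, C, D, by simp⟩
  rw [Set.mem_compl_iff, hcons, ← exists_map_succ_iff]
  constructor
  · rintro ⟨⟨⟨A', B', C', D'⟩, β⟩, h⟩
    exact ⟨B', congrArg (fun Q ↦ Q.2.1) h⟩
  · rintro ⟨B', rfl⟩
    exact ⟨((A, B', (finsetShift C).2, D), (finsetShift C).1), by simp [raiseSnd]⟩

lemma consFst_preimage_level (m t N w : ℤ) :
    consFst ⁻¹' level m t (N + 1) w = level m t N w := by
  ext ⟨A, B, C, D⟩
  simp only [level, consFst, charge, energy, Set.mem_preimage, Set.mem_ofPred_eq,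
    Multiset.card_cons, Multiset.sum_cons, zero_add]
  push_cast
  refine and_congr_left' ?_
  constructor <;> intro h <;> linarith

lemma consSnd_preimage_level (m t N w : ℤ) :
    consSnd ⁻¹' level m t N w = level m t (N + 1) (w - m) := by
  ext ⟨A, B, C, D⟩
  simp only [level, consSnd, charge, energy, Set.mem_preimage, Set.mem_ofPred_eq,
    Multiset.card_cons, Multiset.sum_cons, zero_add]
  push_cast
  refine and_congr ?_ ?_ <;> constructor <;> intro h <;> linarith

lemma raise_preimage_level (m t N w : ℤ) :
    raiseSnd ⁻¹' level m t N (w - m * N) = raiseFst ⁻¹' level m t (N + 1) (w + m - t) := by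
  ext ⟨⟨A, B, C, D⟩, β⟩
  simp only [level, raiseFst, raiseSnd, charge, energy, Set.mem_preimage, Set.mem_ofPred_eq,
    Multiset.card_map, sum_map_succ, card_finsetShift_symm, sum_finsetShift_symm]
  push_cast
  have hβ : ((!β).toNat : ℤ) = 1 - β.toNat := by cases β <;> simp
  rw [hβ]
  refine (and_congr_left' ⟨fun h ↦ ?_, fun h ↦ ?_⟩).trans
    (and_congr_right fun hN ↦ ⟨fun h ↦ ?_, fun h ↦ ?_⟩)
  · linarith
  · linarith
  · obtain rfl : N = _ := (eq_sub_of_add_eq hN.symm)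
    linear_combination h
  · obtain rfl : N = _ := (eq_sub_of_add_eq hN.symm)
    linear_combination h

/-- The functional equation `(1 + x⁻¹) (g (pᵐ x) + pᵗ⁻ᵐ g x) = 0` of the two-variable generating
function of quadruples, read off on coefficients. -/
lemma ncard_level_add_ncard_level_succ {m t : ℤ} (hfin : ∀ N w, (level m t N w).Finite)
    (N w : ℤ) :
    (level m t N (w - m * N)).ncard + (level m t N (w + m - t)).ncard =
      (level m t (N + 1) (w - m * (N + 1))).ncard + (level m t (N + 1) (w + m - t)).ncard := by
  have h₁ := Set.ncard_inter_add_ncard_sdiff_eq_ncard (level m t N (w - m * N)) (Set.range consSnd)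
    (hfin _ _)
  have h₂ := Set.ncard_inter_add_ncard_sdiff_eq_ncard (level m t (N + 1) (w + m - t))
    (Set.range consFst) (hfin _ _)
  rw [Set.sdiff_eq, ← range_raiseSnd, Set.ncard_inter_range_of_injective consSnd_injective,
    Set.ncard_inter_range_of_injective raiseSnd_injective, consSnd_preimage_level,
    raise_preimage_level] at h₁
  rw [Set.sdiff_eq, ← range_raiseFst, Set.ncard_inter_range_of_injective consFst_injective,
    Set.ncard_inter_range_of_injective raiseFst_injective, consFst_preimage_level] at h₂
  rw [show w - m * (N + 1) = w - m * N - m by ring]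
  omega

lemma ncard_level_add_const {m t : ℤ} (hfin : ∀ N w, (level m t N w).Finite) (N w : ℤ) :
    (level m t N (w - m * N)).ncard + (level m t N (w + m - t)).ncard =
      (level m t 0 w).ncard + (level m t 0 (w + m - t)).ncard := by
  induction N using Int.induction_on with
  | zero => simp
  | succ i ih => rw [← ncard_level_add_ncard_level_succ hfin, ih]
  | pred i ih =>
    have := ncard_level_add_ncard_level_succ hfin (-i - 1) w
    rw [sub_add_cancel] at this
    rw [this, ih]

end PartQuad

section Residues

variable {M ρ σ : ℕ}

/-- The quotients by `M` of the elements of `P` that are congruent to `ρ` modulo `M`. -/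
def residueQuotients (M ρ : ℕ) (P : Multiset ℕ) : Multiset ℕ :=
  (P.filter (· % M = ρ)).map (· / M)

lemma residueQuotients_add (P P' : Multiset ℕ) : residueQuotients M ρ (P + P') =
    residueQuotients M ρ P + residueQuotients M ρ P' := by
  simp [residueQuotients]

lemma residueQuotients_map (hσ : σ < M) (A : Multiset ℕ) :
    residueQuotients M ρ (A.map (M * · + σ)) = if σ = ρ then A else 0 := by
  have hM : 0 < M := by omega
  have hmod (x : ℕ) : (M * x + σ) % M = σ := by rw [Nat.mul_add_mod, Nat.mod_eq_of_lt hσ]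
  have hdiv (x : ℕ) : (M * x + σ) / M = x := by
    rw [Nat.mul_add_div hM, Nat.div_eq_of_lt hσ, add_zero]
  split_ifs with h
  · subst h
    simp [residueQuotients, Multiset.filter_map, hmod, hdiv]
  · simp [residueQuotients, Multiset.filter_map, hmod, h]

lemma map_residueQuotients (P : Multiset ℕ) :
    (residueQuotients M ρ P).map (M * · + ρ) = P.filter (· % M = ρ) := by
  rw [residueQuotients, Multiset.map_map]
  conv_rhs => rw [← Multiset.map_id (P.filter (· % M = ρ))]
  refine Multiset.map_congr rfl fun x hx ↦ ?_
  obtain rfl := (Multiset.mem_filter.1 hx).2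
  exact Nat.div_add_mod x M

lemma nodup_residueQuotients {P : Multiset ℕ} (hP : ∀ x ∈ P, x % M = ρ → P.count x ≤ 1) :
    (residueQuotients M ρ P).Nodup := by
  refine Multiset.Nodup.of_map (M * · + ρ) ?_
  rw [map_residueQuotients, Multiset.nodup_iff_count_le_one]
  intro x
  rw [Multiset.count_filter]
  split_ifs with h
  · by_cases hx : x ∈ P
    · exact hP x hx h
    · simp [Multiset.count_eq_zero_of_notMem hx]
  · simp

lemma natCast_zmod_eq_iff (hρ : ρ < M) (x : ℕ) : (x : ZMod M) = ρ ↔ x % M = ρ := by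
  rw [ZMod.natCast_eq_natCast_iff', Nat.mod_eq_of_lt hρ]

lemma natCast_zmod_eq_neg_iff (hρ : 0 < ρ) (hρM : ρ < M) (x : ℕ) :
    (x : ZMod M) = -ρ ↔ x % M = M - ρ := by
  rw [← natCast_zmod_eq_iff (by omega), Nat.cast_sub hρM.le]
  simp

end Residues

namespace PartQuad

/-- The multiset of parts encoded by a quadruple. -/
def toParts (M r b : ℕ) : PartQuad → Multiset ℕ
  | (A, B, C, D) => A.map (M * · + r) + B.map (M * · + (M - r)) + C.val.map (M * · + b) +
      D.val.map (M * · + (M - b))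

/-- The quadruple of a multiset of parts, inverse to `toParts` on admissible multisets. -/
def ofParts (M r b : ℕ) (P : Multiset ℕ) : PartQuad :=
  (residueQuotients M r P, residueQuotients M (M - r) P, (residueQuotients M b P).toFinset,
    (residueQuotients M (M - b) P).toFinset)

/-- The residues `±r`, `±b` modulo `M` are pairwise distinct, with `r` and `b` reduced. -/
structure DistinctResidues (M r b : ℕ) : Prop where
  r_pos : 0 < r
  r_lt : r < M
  b_pos : 0 < b
  b_lt : b < M
  two_r_ne : 2 * r ≠ M
  two_b_ne : 2 * b ≠ M
  r_ne_b : r ≠ b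
  add_ne : r + b ≠ M

variable {M r b : ℕ}

lemma ofParts_toParts (h : DistinctResidues M r b) (Q : PartQuad) :
    ofParts M r b (toParts M r b Q) = Q := by
  obtain ⟨A, B, C, D⟩ := Q
  obtain ⟨h₁, h₂, h₃, h₄, h₅, h₆, h₇, h₈⟩ := h
  have hr : M - r < M := by omega
  have hb : M - b < M := by omega
  have e₁ : M - r ≠ r := by omega
  have e₂ : b ≠ r := by omega
  have e₃ : M - b ≠ r := by omega
  have e₄ : b ≠ M - r := by omega
  have e₅ : M - b ≠ M - r := by omega
  have e₆ : M - b ≠ b := by omega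
  simp [ofParts, toParts, residueQuotients_add, residueQuotients_map, h₂, h₄, hr, hb,
    e₁, e₂, e₃, e₄, e₅, e₆, e₁.symm, e₂.symm, e₃.symm, e₄.symm, e₅.symm, e₆.symm]

lemma toParts_injective (h : DistinctResidues M r b) : Function.Injective (toParts M r b) :=
  Function.LeftInverse.injective (ofParts_toParts h)

lemma toParts_ofParts {m k : ℕ} (h : DistinctResidues (m * k) r b) {P : Multiset ℕ}
    (hP : AdmissibleParts m k r b P) :
    toParts (m * k) r b (ofParts (m * k) r b P) = P := by
  obtain ⟨h₁, h₂, h₃, h₄, h₅, h₆, h₇, h₈⟩ := h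
  obtain ⟨hres, hdist⟩ := hP
  simp only [natCast_zmod_eq_iff h₂, natCast_zmod_eq_iff h₄, natCast_zmod_eq_neg_iff h₁ h₂,
    natCast_zmod_eq_neg_iff h₃ h₄] at hres hdist
  have hb := nodup_residueQuotients fun x hx hxb ↦ hdist x hx (Or.inl hxb)
  have hb' := nodup_residueQuotients fun x hx hxb ↦ hdist x hx (Or.inr hxb)
  simp only [toParts, ofParts, Multiset.toFinset_val, hb.dedup, hb'.dedup, map_residueQuotients]
  ext x
  simp only [Multiset.count_add, Multiset.count_filter]
  by_cases hx : x ∈ P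
  · have := hres x hx
    split_ifs <;> omega
  · simp [Multiset.count_eq_zero_of_notMem hx]

lemma admissibleParts_toParts {m k : ℕ} (h : DistinctResidues (m * k) r b) (Q : PartQuad) :
    AdmissibleParts m k r b (toParts (m * k) r b Q) := by
  obtain ⟨A, B, C, D⟩ := Q
  obtain ⟨h₁, h₂, h₃, h₄, h₅, h₆, h₇, h₈⟩ := h
  have hr : m * k - r < m * k := by omega
  have hb : m * k - b < m * k := by omega
  simp only [AdmissibleParts, natCast_zmod_eq_iff h₂, natCast_zmod_eq_iff h₄,
    natCast_zmod_eq_neg_iff h₁ h₂, natCast_zmod_eq_neg_iff h₃ h₄]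
  constructor
  · intro x hx
    simp only [toParts, Multiset.mem_add, Multiset.mem_map] at hx
    rcases hx with ((⟨j, -, rfl⟩ | ⟨j, -, rfl⟩) | ⟨j, -, rfl⟩) | ⟨j, -, rfl⟩ <;>
      simp [Nat.mod_eq_of_lt, *]
  · intro x hx hxb
    have e₂ : b ≠ r := by omega
    have e₃ : m * k - b ≠ r := by omega
    have e₄ : b ≠ m * k - r := by omega
    have e₅ : m * k - b ≠ m * k - r := by omega
    have e₆ : m * k - b ≠ b := by omega
    have key (ρ : ℕ) (hρ : (residueQuotients (m * k) ρ (toParts (m * k) r b (A, B, C, D))).Nodup)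
        (hx : x % (m * k) = ρ) : (toParts (m * k) r b (A, B, C, D)).count x ≤ 1 := by
      have := Multiset.nodup_iff_count_le_one.1
        (hρ.map (f := (m * k * · + ρ)) fun i j hij ↦ by
          have : 0 < m * k := by omega
          simpa [this.ne'] using hij) x
      rwa [map_residueQuotients, Multiset.count_filter, if_pos hx] at this
    rcases hxb with hxb | hxb
    · refine key _ ?_ hxb
      simp [toParts, residueQuotients_add, residueQuotients_map, h₂, h₄, hr, hb,
        e₂.symm, e₄.symm, e₆, C.nodup]
    · refine key _ ?_ hxb
      simp [toParts, residueQuotients_add, residueQuotients_map, h₂, h₄, hr, hb,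
        e₃.symm, e₅.symm, e₆.symm, D.nodup]

lemma pos_of_mem_toParts (h : DistinctResidues M r b) {Q : PartQuad} {x : ℕ}
    (hx : x ∈ toParts M r b Q) : 0 < x := by
  obtain ⟨A, B, C, D⟩ := Q
  obtain ⟨h₁, h₂, h₃, h₄, -⟩ := h
  simp only [toParts, Multiset.mem_add, Multiset.mem_map] at hx
  rcases hx with ((⟨j, -, rfl⟩ | ⟨j, -, rfl⟩) | ⟨j, -, rfl⟩) | ⟨j, -, rfl⟩ <;> omega

lemma sum_map_mul_add (A : Multiset ℕ) (c d : ℕ) :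
    (A.map (c * · + d)).sum = c * A.sum + A.card * d := by
  rw [Multiset.sum_map_add, Multiset.sum_map_mul_left]
  simp

lemma sum_toParts {m k r t : ℕ} (htk : r < t * k) (htm : t < m) (Q : PartQuad) :
    ((toParts (m * k) r (t * k - r) Q).sum : ℤ) = r * charge Q + k * energy m t Q := by
  obtain ⟨A, B, C, D⟩ := Q
  have htmk : t * k ≤ m * k := Nat.mul_le_mul_right k htm.le
  simp only [toParts, Multiset.sum_add, sum_map_mul_add, charge, energy, Finset.card_val]
  have hC (C : Finset ℕ) : C.val.sum = ∑ j ∈ C, j := by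
    rw [Finset.sum, Multiset.map_id']
  rw [hC, hC]
  have e₁ : r ≤ m * k := by omega
  have e₂ : t * k - r ≤ m * k := by omega
  push_cast [e₁, e₂, htk.le]
  ring

lemma even_card_toParts_iff (Q : PartQuad) :
    Even (toParts M r b Q).card ↔ Even (charge Q) := by
  obtain ⟨A, B, C, D⟩ := Q
  simp only [toParts, charge, Multiset.card_add, Multiset.card_map, Finset.card_val]
  rw [← Int.even_coe_nat]
  push_cast
  simp only [Int.even_add, Int.even_sub]

/-- Admissible partitions of `N` are in bijection with quadruples encoding parts of sum `N`. -/
lemma natCard_partition_eq_ncard {m k N : ℕ} (h : DistinctResidues (m * k) r b) (p : ℕ → Prop) :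
    Nat.card {P : N.Partition // AdmissibleParts m k r b P.parts ∧ p (Multiset.card P.parts)} =
      {Q | (toParts (m * k) r b Q).sum = N ∧ p (toParts (m * k) r b Q).card}.ncard := by
  rw [← Nat.card_coe_set_eq]
  refine (Nat.card_eq_of_bijective (fun Q ↦ ⟨⟨toParts (m * k) r b Q.1, pos_of_mem_toParts h, Q.2.1⟩,
    admissibleParts_toParts h _, Q.2.2⟩) ⟨?_, ?_⟩).symm
  · intro Q Q' hQ
    simp only [Subtype.mk.injEq, Nat.Partition.mk.injEq] at hQ
    exact Subtype.ext (toParts_injective h hQ)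
  · rintro ⟨⟨P, hpos, hsum⟩, hP, hp⟩
    have hPP := toParts_ofParts h hP
    refine ⟨⟨ofParts (m * k) r b P, ?_⟩, ?_⟩
    · simp only [Set.mem_ofPred_eq, hPP]
      exact ⟨hsum, hp⟩
    · simp only [hPP]

lemma finite_setOf_sum_toParts_eq (h : DistinctResidues M r b) (N : ℕ) :
    {Q | (toParts M r b Q).sum = N}.Finite := by
  have : Finite {Q | (toParts M r b Q).sum = N} :=
    Finite.of_injective (β := N.Partition)
      (fun Q ↦ ⟨toParts M r b Q.1, pos_of_mem_toParts h, Q.2⟩) fun Q Q' hQ ↦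
        Subtype.ext (toParts_injective h (congrArg Nat.Partition.parts hQ))
  exact Set.toFinite _

lemma finite_level {m k r t : ℕ} (htk : r < t * k) (htm : t < m)
    (h : DistinctResidues (m * k) r (t * k - r)) (N w : ℤ) : (level m t N w).Finite := by
  refine (finite_setOf_sum_toParts_eq h (r * N + k * w).toNat).subset ?_
  rintro Q ⟨rfl, rfl⟩
  rw [Set.mem_ofPred_eq, ← sum_toParts htk htm, Int.toNat_natCast]

end PartQuad

lemma sum_Icc_neg_eq_sum_range_add (f : ℤ → ℤ) (K : ℕ) :
    ∑ l ∈ Icc (-K : ℤ) (K + 1), f l =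
      ∑ l ∈ range (K + 1), f (l + 1) + ∑ l ∈ range (K + 1), f (-l) := by
  induction K with
  | zero =>
    rw [show Icc (-(0 : ℕ) : ℤ) ((0 : ℕ) + 1) = {1, 0} by decide]
    simp
  | succ K ih =>
    have h : Icc (-(K + 1 : ℕ) : ℤ) ((K + 1 : ℕ) + 1) =
        insert (-(K + 1 : ℤ)) (insert (K + 2 : ℤ) (Icc (-K : ℤ) (K + 1))) := by
      ext x
      simp only [mem_insert, mem_Icc]
      push_cast
      omega
    rw [h, sum_insert (by simp only [mem_insert, mem_Icc]; omega),
      sum_insert (by simp only [mem_Icc]; omega), ih, sum_range_succ _ (K + 1),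
      sum_range_succ _ (K + 1)]
    push_cast
    rw [show (K + 2 : ℤ) = K + 1 + 1 by ring]
    ring

lemma card_filter_even_sub_card_filter_odd {α : Type*} (V : Finset α) (f : α → ℤ) :
    ((V.filter fun a ↦ Even (f a)).card : ℤ) - (V.filter fun a ↦ Odd (f a)).card =
      ∑ a ∈ V, ((f a).negOnePow : ℤ) := by
  rw [card_filter, card_filter]
  push_cast
  rw [← sum_sub_distrib]
  refine sum_congr rfl fun a _ ↦ ?_
  rcases Int.even_or_odd (f a) with h | h
  · simp [h, Int.negOnePow_even _ h]
  · simp [h, Int.negOnePow_odd _ h]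

lemma two_mul_ne_mul_of_coprime_of_odd {k r : ℕ} (hk : 1 < k) (hkodd : Odd k)
    (hgcd : Nat.gcd r k = 1) (x : ℕ) : 2 * r ≠ x * k := by
  intro h
  have hdvd : k ∣ 2 := (Nat.Coprime.symm hgcd).dvd_of_dvd_mul_right (h ▸ dvd_mul_left k x)
  obtain ⟨j, rfl⟩ := hkodd
  have := Nat.le_of_dvd two_pos hdvd
  omega

lemma PartQuad.distinctResidues {m k r t : ℕ} (hk : 1 < k) (hkodd : Odd k) (hgcd : Nat.gcd r k = 1)
    (hr : 0 < r) (htm : t < m) (htk : r < t * k) :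
    PartQuad.DistinctResidues (m * k) r (t * k - r) := by
  have hne := two_mul_ne_mul_of_coprime_of_odd hk hkodd hgcd
  have htmk : t * k < m * k := Nat.mul_lt_mul_of_pos_right htm (by omega)
  refine ⟨hr, by omega, by omega, by omega, hne m, fun h ↦ hne (2 * t - m) ?_, fun h ↦ hne t ?_,
    by omega⟩
  · rw [Nat.sub_mul, mul_assoc]
    omega
  · omega

/-- The integers `N` and `w` with `r N + k w = k n - r (s + 1)` form a one-parameter family. -/
lemma mul_add_mul_eq_iff_exists {k r s n N w : ℤ} (hk : k ≠ 0) (hrk : IsCoprime k r) :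
    r * N + k * w = k * n - r * (s + 1) ↔ ∃ l, N = k * l - s - 1 ∧ w = n - r * l := by
  constructor
  · intro h
    obtain ⟨l, hl⟩ : k ∣ N + s + 1 :=
      hrk.dvd_of_dvd_mul_left ⟨n - w, by linear_combination h⟩
    refine ⟨l, by linarith, mul_left_cancel₀ hk ?_⟩
    linear_combination h - r * hl
  · rintro ⟨l, rfl, rfl⟩
    ring

open PartQuad in
/-- The signed count of the quadruples encoding parts of sum `k n - r (s + 1)` vanishes. -/
lemma sum_negOnePow_charge_eq_zero {m k s t r n : ℕ} (hkodd : Odd k) (hr : r = s * m + t)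
    (ht : 0 < t) (htm : t < m) (htk : r < t * k) (hgcd : Nat.gcd r k = 1)
    (hfin : ∀ N w, (level m t N w).Finite) (V : Finset PartQuad)
    (hV : ∀ Q, Q ∈ V ↔ r * charge Q + k * energy m t Q = k * n - r * (s + 1)) :
    ∑ Q ∈ V, ((charge Q).negOnePow : ℤ) = 0 := by
  have hk0 : (k : ℤ) ≠ 0 := by
    rintro h
    simp_all
  have hrk : IsCoprime (k : ℤ) r := (Nat.isCoprime_iff_coprime.2 hgcd).symm
  have hV' (Q) : Q ∈ V ↔ ∃ l : ℤ, Q ∈ level m t (k * l - s - 1) (n - r * l) := by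
    rw [hV, mul_add_mul_eq_iff_exists hk0 hrk]
    rfl
  let idx (Q : PartQuad) : ℤ := (charge Q + s + 1) / k
  have hidx {Q : PartQuad} {l w : ℤ} (hQ : Q ∈ level m t (k * l - s - 1) w) : idx Q = l := by
    simp only [idx, hQ.1]
    rw [show k * l - s - 1 + s + 1 = k * l by ring, Int.mul_ediv_cancel_left _ hk0]
  have hfiber (l : ℤ) : ((V.filter fun Q ↦ idx Q = l).card : ℤ) =
      (level m t (k * l - s - 1) (n - r * l)).ncard := by
    rw [← Set.ncard_coe_finset]
    congr 2
    ext Q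
    simp only [coe_filter, Set.mem_ofPred_eq, hV']
    constructor
    · rintro ⟨⟨l', hl'⟩, rfl⟩
      rwa [hidx hl']
    · intro hQ
      exact ⟨⟨l, hQ⟩, hidx hQ⟩
  obtain ⟨K, hnK, hK⟩ : ∃ K : ℕ, n ≤ K ∧ ∀ Q ∈ V, idx Q ∈ Icc (-K : ℤ) (K + 1) := by
    refine ⟨n + ∑ Q ∈ V, (idx Q).natAbs, by omega, fun Q hQ ↦ ?_⟩
    have := single_le_sum (f := fun Q ↦ (idx Q).natAbs) (fun _ _ ↦ Nat.zero_le _) hQ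
    rw [mem_Icc]
    omega
  have hterm (l : ℤ) : ∑ Q ∈ V with idx Q = l, ((charge Q).negOnePow : ℤ) =
      ((s + 1 : ℤ).negOnePow : ℤ) *
        (l.negOnePow * (level m t (k * l - s - 1) (n - r * l)).ncard) := by
    rw [← hfiber, ← mul_assoc, mul_comm, ← nsmul_eq_mul, ← sum_const]
    refine sum_congr rfl fun Q hQ ↦ ?_
    obtain ⟨hQV, rfl⟩ := mem_filter.1 hQ
    obtain ⟨l, hl⟩ := (hV' Q).1 hQV
    rw [hidx hl, hl.1, sub_sub, Int.negOnePow_sub, mul_comm, Units.val_mul]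
    congr 2
    rcases Int.even_or_odd l with h | h
    · rw [Int.negOnePow_even _ h, Int.negOnePow_even _ (h.mul_left _)]
    · rw [Int.negOnePow_odd _ h, Int.negOnePow_odd _ (((Int.odd_coe_nat k).2 hkodd).mul h)]
  rw [← sum_fiberwise_of_maps_to hK]
  simp_rw [hterm]
  rw [← mul_sum, sum_Icc_neg_eq_sum_range_add]
  have hrd : (r : ℤ) < m * k := by
    have : t * k ≤ m * k := Nat.mul_le_mul_right k htm.le
    exact_mod_cast htk.trans_le this
  have hr0 : (0 : ℤ) < r := by
    have : 0 < r := by rw [hr]; positivity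
    exact_mod_cast this
  have hzero := alternating_diagonal_sum_eq_zero
    (fun l w ↦ ((level m t (k * l - s - 1) w).ncard : ℤ))
    (fun w ↦ (level m t 0 (w - m + t)).ncard + (level m t 0 w).ncard) r (m * k) n K hr0 hrd
    (fun l w hw ↦ by
      have : level m t (k * l - s - 1) w = ∅ := by
        refine Set.eq_empty_of_forall_notMem fun Q hQ ↦ hw.not_ge ?_
        rw [← hQ.2]
        exact energy_nonneg (by positivity) (by exact_mod_cast htm.le) Q
      simp [this])
    (fun l w ↦ by
      have := ncard_level_add_const hfin (k * l - s - 1) (w - m + t)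
      rw [show w - m + t + m - t = w by ring,
        show w - m + t - m * (k * l - s - 1) = w - (m * k * l - r) by rw [hr]; push_cast; ring,
        add_comm] at this
      exact_mod_cast this)
    hnK
  have hsign (l : ℕ) : ((l : ℤ).negOnePow : ℤ) = (-1) ^ l := by
    simp [Int.negOnePow_def]
  have hsign' (l : ℕ) : ((l + 1 : ℤ).negOnePow : ℤ) = (-1) ^ (l + 1) := by
    exact_mod_cast hsign (l + 1)
  simp only [Int.negOnePow_neg, hsign, hsign', mul_neg, sub_neg_eq_add] at hzero ⊢
  rw [hzero, mul_zero]

/-- Let `k > 1` be odd, `m > 1`, `0 ≤ s < k`, `1 ≤ t < m`, `r = sm + t` with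
`gcd(r, k) = 1` and `r - tk < 0`. Then for every `n` with `nk - r(s+1) ≥ 0`, the number
of admissible partitions of `nk - r(s+1)` (parts `≡ ±r (mod mk)` possibly repeated,
together with distinct parts `≡ ±(tk - r) (mod mk)`) with an even number of parts equals
the number of such partitions with an odd number of parts. -/
theorem even_eq_odd_partition_count (k m s t : ℕ) (hk : 1 < k) (hkodd : Odd k)
    (hm : 1 < m) (hs : s < k) (ht1 : 1 ≤ t) (ht2 : t < m)
    (r : ℕ) (hr : r = s * m + t) (hgcd : Nat.gcd r k = 1) (htk : r < t * k) :
    ∀ n : ℕ, r * (s + 1) ≤ k * n →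
      evenPartitionCount m k r (t * k - r) (k * n - r * (s + 1)) =
        oddPartitionCount m k r (t * k - r) (k * n - r * (s + 1)) := by
  intro n hn
  have hr0 : 0 < r := by rw [hr]; positivity
  have hD := PartQuad.distinctResidues hk hkodd hgcd hr0 ht2 htk
  have hfinV := PartQuad.finite_setOf_sum_toParts_eq hD (k * n - r * (s + 1))
  have hmem (Q : PartQuad) : Q ∈ hfinV.toFinset ↔
      (r : ℤ) * Q.charge + k * PartQuad.energy m t Q = k * n - r * (s + 1) := by
    rw [Set.Finite.mem_toFinset, Set.mem_ofPred_eq, ← PartQuad.sum_toParts htk ht2]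
    zify [hn]
  have hsum := sum_negOnePow_charge_eq_zero hkodd hr ht1 ht2 htk hgcd
    (PartQuad.finite_level htk ht2 hD) hfinV.toFinset hmem
  rw [← card_filter_even_sub_card_filter_odd, sub_eq_zero, Nat.cast_inj] at hsum
  rw [evenPartitionCount, oddPartitionCount, PartQuad.natCard_partition_eq_ncard hD,
    PartQuad.natCard_partition_eq_ncard hD]
  simp only [← Nat.not_even_iff_odd, ← Int.not_even_iff_odd,
    PartQuad.even_card_toParts_iff] at hsum ⊢
  rw [← Set.ncard_coe_finset, ← Set.ncard_coe_finset] at hsum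
  simpa using hsum
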